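/- arXiv:2307.06591 — 3 statements merged into one kernel-verified Lean document; each statement's English description precedes it below -/
import Mathlib

section
/- The closure, in the space of d×d real matrices, of the set of totally positive upper triangular unipotent matrices is exactly the set of totally nonnegative upper triangular unipotent matrices. -/
open Matrix

/-- An upper triangular unipotent `d × d` real matrix: all entries below the
diagonal vanish and all diagonal entries equal `1`. -/
def UTUnipotent {d : ℕ} (u : Matrix (Fin d) (Fin d) ℝ) : Prop :=
  (∀ i j : Fin d, (j : ℕ) < (i : ℕ) → u i j = 0) ∧ ∀ i : Fin d, u i i = 1

/-- A (square, upper triangular unipotent) matrix is totally positive if all of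
its non-trivial minors are positive: for all strictly increasing index tuples
`I J : Fin k → Fin d` with `I p ≤ J p` for all `p`, the corresponding minor is
positive. -/
def TotallyPositive {d : ℕ} (u : Matrix (Fin d) (Fin d) ℝ) : Prop :=
  ∀ k : ℕ, 1 ≤ k → k ≤ d → ∀ I J : Fin k → Fin d,
    StrictMono I → StrictMono J → (∀ p, I p ≤ J p) → 0 < (u.submatrix I J).det

/-- A (square, upper triangular unipotent) matrix is totally nonnegative if all
of its non-trivial minors are nonnegative. -/
def TotallyNonneg {d : ℕ} (u : Matrix (Fin d) (Fin d) ℝ) : Prop :=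
  ∀ k : ℕ, 1 ≤ k → k ≤ d → ∀ I J : Fin k → Fin d,
    StrictMono I → StrictMono J → (∀ p, I p ≤ J p) → 0 ≤ (u.submatrix I J).det

/-- The `d`-th upper triangular Pascal matrix: its `(i,j)` entry (`0`-indexed)
is `C(j,i)` when `i ≤ j` and `0` otherwise. -/
def pascal (d : ℕ) : Matrix (Fin d) (Fin d) ℝ :=
  Matrix.of fun i j => if (i : ℕ) ≤ (j : ℕ) then ((j : ℕ).choose (i : ℕ) : ℝ) else 0

/-- A tuple `I : Fin k → Fin d` is consecutive if `I p = I 0 + p` for all `p`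
(stated symmetrically so that it also makes sense for `k = 0`). -/
def Consecutive {d k : ℕ} (I : Fin k → Fin d) : Prop :=
  ∀ p q : Fin k, (I p : ℕ) + (q : ℕ) = (I q : ℕ) + (p : ℕ)

/-- The row indices `(0, 1, …, k-1)` of the top-right corner `k × k` minor. -/
def cornerI {d : ℕ} (k : ℕ) (hk : k ≤ d) : Fin k → Fin d :=
  fun p => ⟨(p : ℕ), lt_of_lt_of_le p.isLt hk⟩

/-- The column indices `(d-k, d-k+1, …, d-1)` of the top-right corner `k × k`
minor. -/
def cornerJ {d : ℕ} (k : ℕ) (hk : k ≤ d) : Fin k → Fin d :=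
  fun p => ⟨d - k + (p : ℕ), by have h := p.isLt; omega⟩

/-- Multilinear expansion of the determinant of a product along its rows. -/
theorem det_mul_eq_sum_prod_mul_det {m n R : Type*} [Fintype m] [DecidableEq m] [Fintype n]
    [CommRing R] (A : Matrix m n R) (B : Matrix n m R) :
    (A * B).det = ∑ f : m → n, (∏ i, A i (f i)) * (B.submatrix f id).det := by
  classical
  have hrow : (A * B : Matrix m m R) = fun i => ∑ j, A i j • B j := by
    ext i l
    simp [Matrix.mul_apply, Finset.sum_apply]
  have h := (detRowAlternating (R := R) (n := m)).toMultilinearMap.map_sum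
    (fun i j => A i j • B j)
  simp only [MultilinearMap.map_smul_univ] at h
  rw [hrow]
  exact h

/-- The Cauchy-Binet formula, with every set of intermediate indices counted once for each of its
orderings. -/
theorem factorial_smul_det_mul {m n R : Type*} [Fintype m] [DecidableEq m] [Fintype n]
    [CommRing R] (A : Matrix m n R) (B : Matrix n m R) :
    (Fintype.card m).factorial • (A * B).det =
      ∑ f : m → n, (A.submatrix id f).det * (B.submatrix f id).det := by
  classical
  have hσ (σ : Equiv.Perm m) :
      ∑ f : m → n, ((Equiv.Perm.sign σ : ℤ) : R) * (∏ i, A (σ i) (f i)) * (B.submatrix f id).det =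
        (A * B).det := by
    rw [det_mul_eq_sum_prod_mul_det, ← (Equiv.arrowCongr σ (Equiv.refl n)).symm.sum_comp]
    refine Finset.sum_congr rfl fun f _ => ?_
    have hB : (B.submatrix (f ∘ σ) id).det =
        ((Equiv.Perm.sign σ : ℤ) : R) * (B.submatrix f id).det :=
      det_permute σ (B.submatrix f id)
    have hA : ∏ i, A (σ i) (f (σ i)) = ∏ i, A i (f i) := Equiv.prod_comp σ fun i => A i (f i)
    have hs : ((Equiv.Perm.sign σ : ℤ) : R) * ((Equiv.Perm.sign σ : ℤ) : R) = 1 := by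
      rw [← Int.cast_mul, ← Units.val_mul, Int.units_mul_self]
      simp
    change ((Equiv.Perm.sign σ : ℤ) : R) * (∏ i, A (σ i) (f (σ i))) *
      (B.submatrix (f ∘ σ) id).det = _
    rw [hA, hB]
    linear_combination (∏ i, A i (f i)) * (B.submatrix f id).det * hs
  simp only [det_apply' (A.submatrix id _), Finset.sum_mul, submatrix_apply, id_eq]
  rw [Finset.sum_comm, Finset.sum_congr rfl fun σ _ => hσ σ]
  simp [Fintype.card_perm]

section Minors

variable {d k : ℕ} {u v : Matrix (Fin d) (Fin d) ℝ}

theorem UTUnipotent.det_submatrix_self (hu : UTUnipotent u) {I : Fin k → Fin d}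
    (hI : StrictMono I) : (u.submatrix I I).det = 1 := by
  rw [det_of_isUpperTriangular]
  · simp [hu.2]
  · intro i j hij
    exact hu.1 _ _ (hI hij)

theorem UTUnipotent.det_submatrix_eq_zero (hu : UTUnipotent u) {I J : Fin k → Fin d}
    (hI : StrictMono I) (hJ : StrictMono J) (h : ¬ ∀ p, I p ≤ J p) :
    (u.submatrix I J).det = 0 := by
  push Not at h
  obtain ⟨p, hp⟩ := h
  rw [det_apply']
  refine Finset.sum_eq_zero fun σ _ => mul_eq_zero_of_right _ ?_
  obtain ⟨a, ha, hσa⟩ : ∃ a, a ≤ p ∧ p ≤ σ a := by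
    by_contra! hc
    have := Finset.card_le_card_of_injOn (s := Finset.Iic p) (t := Finset.Iio p) σ
      (fun a ha => by simpa using hc a (by simpa using ha)) σ.injective.injOn
    simp at this
  refine Finset.prod_eq_zero (Finset.mem_univ a) (hu.1 _ _ ?_)
  exact ((hJ.monotone ha).trans_lt hp).trans_le (hI.monotone hσa)

theorem TotallyPositive.totallyNonneg (hu : TotallyPositive u) : TotallyNonneg u :=
  fun k hk hkd I J hI hJ h => (hu k hk hkd I J hI hJ h).le

theorem TotallyNonneg.det_submatrix_nonneg (hu : UTUnipotent u) (hu' : TotallyNonneg u)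
    {I J : Fin k → Fin d} (hI : StrictMono I) (hJ : StrictMono J) :
    0 ≤ (u.submatrix I J).det := by
  by_cases h : ∀ p, I p ≤ J p
  · rcases Nat.eq_zero_or_pos k with rfl | hk
    · simp
    · exact hu' k hk (by simpa using Fintype.card_le_of_injective I hI.injective) I J hI hJ h
  · exact (hu.det_submatrix_eq_zero hI hJ h).ge

theorem UTUnipotent.mul (hu : UTUnipotent u) (hv : UTUnipotent v) : UTUnipotent (u * v) := by
  refine ⟨fun i j hij => ?_, fun i => ?_⟩
  · rw [mul_apply]
    refine Finset.sum_eq_zero fun l _ => ?_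
    rcases lt_or_ge (l : ℕ) (i : ℕ) with h | h
    · rw [hu.1 _ _ h, zero_mul]
    · rw [hv.1 _ _ (hij.trans_le h), mul_zero]
  · rw [mul_apply, Finset.sum_eq_single i, hu.2, hv.2, one_mul]
    · intro l _ hl
      rcases lt_or_gt_of_ne hl with h | h
      · rw [hu.1 _ _ h, zero_mul]
      · rw [hv.1 _ _ h, mul_zero]
    · simp

/-- The product of a totally positive and a totally nonnegative matrix is totally positive. -/
theorem TotallyPositive.mul_totallyNonneg (hu : UTUnipotent u) (hu' : TotallyPositive u)
    (hv : UTUnipotent v) (hv' : TotallyNonneg v) : TotallyPositive (u * v) := by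
  intro k hk hkd I J hI hJ h
  have hfac := factorial_smul_det_mul (u.submatrix I id) (v.submatrix id J)
  have hsub : (u * v).submatrix I J = u.submatrix I id * v.submatrix id J :=
    submatrix_mul _ _ _ _ _ Function.bijective_id
  rw [← hsub] at hfac
  simp only [submatrix_submatrix, Function.comp_id, Function.id_comp] at hfac
  have hpos : 0 < ∑ f : Fin k → Fin d, (u.submatrix I f).det * (v.submatrix f J).det := by
    refine Finset.sum_pos' (fun f _ => ?_) ⟨J, Finset.mem_univ _, ?_⟩
    · by_cases hf : Function.Injective f
      · have hsort : StrictMono (f ∘ Tuple.sort f) :=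
          (Tuple.monotone_sort f).strictMono_of_injective (hf.comp (Tuple.sort f).injective)
        have h1 := hu'.totallyNonneg.det_submatrix_nonneg hu hI hsort
        have h2 := hv'.det_submatrix_nonneg hv hsort hJ
        have e1 : (u.submatrix I (f ∘ Tuple.sort f)).det = _ :=
          det_permute' (Tuple.sort f) (u.submatrix I f)
        have e2 : (v.submatrix (f ∘ Tuple.sort f) J).det = _ :=
          det_permute (Tuple.sort f) (v.submatrix f J)
        have h3 := mul_nonneg h1 h2
        rw [e1, e2] at h3
        rcases Int.units_eq_one_or (Equiv.Perm.sign (Tuple.sort f)) with hs | hs <;>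
          simpa [hs] using h3
      · obtain ⟨a, b, hab, hne⟩ := Function.not_injective_iff.mp hf
        rw [det_zero_of_row_eq (M := v.submatrix f J) hne (by ext; simp [hab]), mul_zero]
    · rw [hv.det_submatrix_self hJ, mul_one]
      exact hu' k hk hkd I J hI hJ h
  rw [← hfac, nsmul_eq_mul] at hpos
  exact pos_of_mul_pos_right hpos (Nat.cast_nonneg _)

end Minors

/-- The upper triangular unipotent matrix with entries `q ^ (j - i) ^ 2` for `i ≤ j`. -/
def gaussianUpper (d : ℕ) (q : ℝ) : Matrix (Fin d) (Fin d) ℝ :=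
  Matrix.of fun i j => if i ≤ j then q ^ ((j : ℕ) - (i : ℕ)) ^ 2 else 0

theorem gaussianUpper_utUnipotent (d : ℕ) (q : ℝ) : UTUnipotent (gaussianUpper d q) :=
  ⟨fun i j h => by simp [gaussianUpper, not_le.mpr (Fin.lt_def.mpr h)],
    fun i => by simp [gaussianUpper]⟩

theorem gaussianUpper_zero (d : ℕ) : gaussianUpper d 0 = 1 := by
  ext i j
  rcases lt_trichotomy i j with h | rfl | h
  · have : (j : ℕ) - i ≠ 0 := by have := Fin.lt_def.mp h; omega
    simp [gaussianUpper, h.le, h.ne, this]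
  · simp [gaussianUpper]
  · simp [gaussianUpper, not_le.mpr h, h.ne']

theorem continuous_gaussianUpper (d : ℕ) : Continuous (gaussianUpper d) := by
  refine continuous_matrix fun i j => ?_
  by_cases h : i ≤ j <;> simp only [gaussianUpper, of_apply, h, if_true, if_false] <;> fun_prop

/-- A consequence of the strict rearrangement inequality. -/
theorem sum_sub_sq_lt_sum_comp_perm_sub_sq {d k : ℕ} {I J : Fin k → Fin d} (hI : StrictMono I)
    (hJ : StrictMono J) (h : ∀ p, I p ≤ J p) {σ : Equiv.Perm (Fin k)} (hσ : σ ≠ 1)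
    (hIJ : ∀ p, I (σ p) ≤ J p) :
    ∑ p, ((J p : ℕ) - (I p : ℕ)) ^ 2 < ∑ p, ((J p : ℕ) - (I (σ p) : ℕ)) ^ 2 := by
  have hlt : ∑ p, ((I (σ p) : ℕ) : ℤ) * ((J p : ℕ) : ℤ) <
      ∑ p, ((I p : ℕ) : ℤ) * ((J p : ℕ) : ℤ) := by
    have hmono : Monovary (fun p => ((I p : ℕ) : ℤ)) (fun p => ((J p : ℕ) : ℤ)) := by
      intro a b hab
      have : a < b := hJ.lt_iff_lt.mp (Fin.lt_def.mpr (Nat.cast_lt.mp hab))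
      exact Nat.cast_le.mpr (Fin.le_def.mp (hI this).le)
    refine hmono.sum_comp_perm_mul_lt_sum_mul_iff.mpr fun hv => hσ ?_
    have hm : Monotone (I ∘ σ) := by
      intro a b hab
      rcases hab.eq_or_lt with rfl | hab
      · exact le_rfl
      · have hJab : ((J a : ℕ) : ℤ) < ((J b : ℕ) : ℤ) := by exact_mod_cast Fin.lt_def.mp (hJ hab)
        exact Fin.le_def.mpr (Nat.cast_le.mp (hv hJab))
    have heq := Tuple.unique_monotone (f := I) (σ := σ) (τ := 1) hm hI.monotone
    ext p
    exact congrArg Fin.val (hI.injective (congrFun heq p))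
  have hsq : ∑ p, ((I (σ p) : ℕ) : ℤ) ^ 2 = ∑ p, ((I p : ℕ) : ℤ) ^ 2 :=
    Equiv.sum_comp σ fun p => ((I p : ℕ) : ℤ) ^ 2
  have hcast (τ : Equiv.Perm (Fin k)) (hτ : ∀ p, I (τ p) ≤ J p) :
      ((∑ p, ((J p : ℕ) - (I (τ p) : ℕ)) ^ 2 : ℕ) : ℤ) =
        ∑ p, ((J p : ℕ) : ℤ) ^ 2 - 2 * ∑ p, ((I (τ p) : ℕ) : ℤ) * ((J p : ℕ) : ℤ) +
          ∑ p, ((I (τ p) : ℕ) : ℤ) ^ 2 := by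
    rw [Finset.mul_sum, ← Finset.sum_sub_distrib, ← Finset.sum_add_distrib, Nat.cast_sum]
    refine Finset.sum_congr rfl fun p _ => ?_
    rw [Nat.cast_pow, Nat.cast_sub (Fin.le_def.mp (hτ p))]
    ring
  have h1 := hcast 1 h
  have h2 := hcast σ hIJ
  simp only [Equiv.Perm.one_apply] at h1
  zify at h1 h2 ⊢
  linarith

theorem gaussianUpper_totallyPositive {d : ℕ} {q : ℝ} (hq : 0 < q) (hqd : d.factorial * q < 1) :
    TotallyPositive (gaussianUpper d q) := by
  intro k _ hkd I J hI hJ h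
  set e := ∑ p, ((J p : ℕ) - (I p : ℕ)) ^ 2
  have hkq : k.factorial * q < 1 :=
    (mul_le_mul_of_nonneg_right (Nat.cast_le.mpr (Nat.factorial_le hkd)) hq.le).trans_lt hqd
  have hq1 : q ≤ 1 := by
    have : (1 : ℝ) ≤ k.factorial := Nat.one_le_cast.mpr k.factorial_pos
    nlinarith
  have hone : ∏ p, gaussianUpper d q (I p) (J p) = q ^ e := by
    simp [gaussianUpper, h, Finset.prod_pow_eq_pow_sum, e]
  have hother (σ : Equiv.Perm (Fin k)) (hσ : σ ≠ 1) :
      |∏ p, gaussianUpper d q (I (σ p)) (J p)| ≤ q ^ (e + 1) := by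
    by_cases hIJ : ∀ p, I (σ p) ≤ J p
    · simp only [gaussianUpper, of_apply, hIJ, if_true, Finset.prod_pow_eq_pow_sum]
      rw [abs_of_nonneg (by positivity)]
      exact pow_le_pow_of_le_one hq.le hq1 (sum_sub_sq_lt_sum_comp_perm_sub_sq hI hJ h hσ hIJ)
    · push Not at hIJ
      obtain ⟨p, hp⟩ := hIJ
      rw [Finset.prod_eq_zero (Finset.mem_univ p), abs_zero]
      · positivity
      · simp [gaussianUpper, not_le.mpr hp]
  rw [det_apply', ← Finset.add_sum_erase _ _ (Finset.mem_univ (1 : Equiv.Perm (Fin k)))]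
  have hsum := Finset.card_nsmul_le_sum (Finset.univ.erase (1 : Equiv.Perm (Fin k)))
    (fun σ => ((Equiv.Perm.sign σ : ℤ) : ℝ) * ∏ p, (gaussianUpper d q).submatrix I J (σ p) p)
    (-q ^ (e + 1)) fun σ hσ => by
      have hle := hother σ (Finset.ne_of_mem_erase hσ)
      rw [abs_le] at hle
      simp only [submatrix_apply]
      rcases Int.units_eq_one_or (Equiv.Perm.sign σ) with hs | hs <;> simp [hs] <;> linarith
  have hcard : ((Finset.univ.erase (1 : Equiv.Perm (Fin k))).card : ℝ) ≤ k.factorial := by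
    refine Nat.cast_le.mpr (Finset.card_le_univ _ |>.trans ?_)
    simp [Fintype.card_perm]
  rw [nsmul_eq_mul] at hsum
  simp only [Equiv.Perm.sign_one, Units.val_one, Int.cast_one, one_mul, Equiv.Perm.one_apply,
    submatrix_apply, hone] at hsum ⊢
  have hqe : 0 < q ^ e := by positivity
  have h1 := mul_le_mul_of_nonneg_right hcard (pow_pos hq (e + 1)).le
  rw [pow_succ] at h1 hsum
  nlinarith [mul_lt_mul_of_pos_left hkq hqe]

theorem isClosed_utUnipotent_totallyNonneg (d : ℕ) :
    IsClosed {u : Matrix (Fin d) (Fin d) ℝ | UTUnipotent u ∧ TotallyNonneg u} := by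
  simp only [UTUnipotent, TotallyNonneg, Set.ofPred_and, Set.ofPred_forall]
  refine ((isClosed_iInter fun i => isClosed_iInter fun j => isClosed_iInter fun _ => ?_).inter
    (isClosed_iInter fun i => ?_)).inter
    (isClosed_iInter fun k => isClosed_iInter fun _ => isClosed_iInter fun _ =>
      isClosed_iInter fun I => isClosed_iInter fun J => isClosed_iInter fun _ =>
        isClosed_iInter fun _ => isClosed_iInter fun _ => ?_)
  · exact isClosed_eq (continuous_id.matrix_elem i j) continuous_const
  · exact isClosed_eq (continuous_id.matrix_elem i i) continuous_const
  · exact isClosed_le continuous_const (continuous_id.matrix_submatrix I J).matrix_det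

/-- The closure, in the space of `d × d` real matrices, of the
set of totally positive upper triangular unipotent matrices is exactly the set
of totally nonnegative upper triangular unipotent matrices. -/
theorem closure_totallyPositive_eq_totallyNonneg (d : ℕ) :
    closure {u : Matrix (Fin d) (Fin d) ℝ | UTUnipotent u ∧ TotallyPositive u} =
      {u : Matrix (Fin d) (Fin d) ℝ | UTUnipotent u ∧ TotallyNonneg u} := by
  refine Set.Subset.antisymm ?_ fun u hu => ?_
  · exact closure_minimal (fun u hu => ⟨hu.1, hu.2.totallyNonneg⟩)
      (isClosed_utUnipotent_totallyNonneg d)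
  · have hlim : Filter.Tendsto (fun q => gaussianUpper d q * u) (nhdsWithin 0 (Set.Ioi 0))
        (nhds u) := by
      have hc : Continuous fun q => gaussianUpper d q * u :=
        (continuous_gaussianUpper d).matrix_mul continuous_const
      have h0 := hc.tendsto 0
      rw [gaussianUpper_zero, one_mul] at h0
      exact h0.mono_left nhdsWithin_le_nhds
    have hsmall : ∀ᶠ q : ℝ in nhdsWithin 0 (Set.Ioi 0), d.factorial * q < 1 := by
      have hc : Continuous fun q : ℝ => d.factorial * q := continuous_const.mul continuous_id
      exact nhdsWithin_le_nhds (hc.tendsto 0 |>.eventually_lt_const (by simp))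
    refine mem_closure_of_tendsto hlim ?_
    filter_upwards [hsmall, self_mem_nhdsWithin] with q hq hpos
    have hp := gaussianUpper_utUnipotent d q
    exact ⟨hp.mul hu.1, (gaussianUpper_totallyPositive hpos hq).mul_totallyNonneg hp hu.1 hu.2⟩
end

section
/- Let u be a d×d real totally nonnegative upper triangular unipotent matrix that is not totally positive. Then there exists k with 1 ≤ k ≤ d−1 such that the top-right corner k×k minor of u vanishes: det(u.submatrix I₀ J₀) = 0, where I₀ = (0, 1, …, k−1) and J₀ = (d−k, d−k+1, …, d−1) (0-indexed). -/
open Matrix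

/-- All minors of `A`, taken along increasing index tuples, are nonnegative. -/
def MinorsNonneg {m n : ℕ} (A : Matrix (Fin m) (Fin n) ℝ) : Prop :=
  ∀ (k : ℕ) (I : Fin k → Fin m) (J : Fin k → Fin n),
    StrictMono I → StrictMono J → 0 ≤ (A.submatrix I J).det

theorem MinorsNonneg.submatrix {m n m' n' : ℕ} {A : Matrix (Fin m) (Fin n) ℝ}
    (hA : MinorsNonneg A) {f : Fin m' → Fin m} {g : Fin n' → Fin n}
    (hf : StrictMono f) (hg : StrictMono g) : MinorsNonneg (A.submatrix f g) :=
  fun k I J hI hJ => hA k (f ∘ I) (g ∘ J) (hf.comp hI) (hg.comp hJ)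

theorem strictMono_rev_comp_rev {k n : ℕ} {I : Fin k → Fin n} (hI : StrictMono I) :
    StrictMono fun p : Fin k => (I p.rev).rev :=
  fun _ _ h => Fin.rev_lt_rev.2 (hI (Fin.rev_lt_rev.2 h))

theorem det_submatrix_rev {k : ℕ} {m n : Type*} (A : Matrix m n ℝ) (I : Fin k → m)
    (J : Fin k → n) :
    (A.submatrix (fun p : Fin k => I p.rev) (fun p : Fin k => J p.rev)).det = (A.submatrix I J).det :=
  det_submatrix_equiv_self Fin.revPerm (A.submatrix I J)

theorem MinorsNonneg.rev {m n : ℕ} {A : Matrix (Fin m) (Fin n) ℝ} (hA : MinorsNonneg A) :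
    MinorsNonneg (A.submatrix Fin.rev Fin.rev) := by
  intro k I J hI hJ
  have h := hA k _ _ (strictMono_rev_comp_rev hI) (strictMono_rev_comp_rev hJ)
  rwa [det_submatrix_rev A (fun p => (I p).rev) (fun p => (J p).rev)] at h

/-- The Schur complement of the top-left entry. -/
noncomputable def schurCompl {m n : ℕ} (A : Matrix (Fin (m + 1)) (Fin (n + 1)) ℝ) :
    Matrix (Fin m) (Fin n) ℝ :=
  Matrix.of fun i j => A i.succ j.succ - A i.succ 0 / A 0 0 * A 0 j.succ

theorem det_eq_mul_det_schurCompl {n : ℕ} (A : Matrix (Fin (n + 1)) (Fin (n + 1)) ℝ)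
    (h : A 0 0 ≠ 0) : A.det = A 0 0 * (schurCompl A).det := by
  have key : A.det = (Matrix.of fun i j => (Fin.cons (A 0 j)
      (fun i' : Fin n => A i'.succ j - A i'.succ 0 / A 0 0 * A 0 j) : Fin (n + 1) → ℝ) i).det := by
    refine det_eq_of_forall_row_eq_smul_add_const
      (Fin.cons 0 fun i' : Fin n => A i'.succ 0 / A 0 0) 0 (by simp) ?_
    intro i j
    cases i using Fin.cases <;> simp
  rw [key, det_succ_column_zero, Fin.sum_univ_succ, Finset.sum_eq_zero]
  · simp only [Fin.val_zero, pow_zero, one_mul, add_zero, of_apply, Fin.cons_zero]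
    congr 1
  · intro i _
    simp [h]

theorem MinorsNonneg.schurCompl {m n : ℕ} {A : Matrix (Fin (m + 1)) (Fin (n + 1)) ℝ}
    (hA : MinorsNonneg A) (h : 0 < A 0 0) : MinorsNonneg (schurCompl A) := by
  intro k I J hI hJ
  have mono : ∀ {l : ℕ} {K : Fin k → Fin l}, StrictMono K →
      StrictMono (Fin.cons 0 (fun p => (K p).succ) : Fin (k + 1) → Fin (l + 1)) := by
    intro l K hK
    rw [Fin.strictMono_iff_lt_succ]
    intro p
    cases k with
    | zero => exact p.elim0
    | succ k =>
      cases p using Fin.cases with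
      | zero => simp
      | succ p =>
        rw [← Fin.succ_castSucc, Fin.cons_succ, Fin.cons_succ]
        exact Fin.succ_lt_succ_iff.2 (hK p.castSucc_lt_succ)
  have h1 := hA (k + 1) _ _ (mono hI) (mono hJ)
  rw [det_eq_mul_det_schurCompl _ (by simpa using h.ne')] at h1
  exact nonneg_of_mul_nonneg_right h1 (by simpa using h)

theorem MinorsNonneg.apply_nonneg {m n : ℕ} {A : Matrix (Fin m) (Fin n) ℝ}
    (hA : MinorsNonneg A) (i : Fin m) (j : Fin n) : 0 ≤ A i j := by
  simpa using hA 1 (fun _ => i) (fun _ => j) (Subsingleton.strictMono _)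
    (Subsingleton.strictMono _)

theorem MinorsNonneg.zero_zero_pos {n : ℕ} {A : Matrix (Fin (n + 1)) (Fin (n + 1)) ℝ}
    (hA : MinorsNonneg A) (h : 0 < A.det) : 0 < A 0 0 := by
  by_contra h0
  have h0 : A 0 0 = 0 := le_antisymm (not_lt.1 h0) (hA.apply_nonneg 0 0)
  obtain ⟨i, hi⟩ : ∃ i, A i 0 ≠ 0 := by
    by_contra! hc
    exact h.ne' (det_eq_zero_of_column_eq_zero 0 hc)
  obtain ⟨j, hj⟩ : ∃ j, A 0 j ≠ 0 := by
    by_contra! hc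
    exact h.ne' (det_eq_zero_of_row_eq_zero 0 hc)
  have mono : ∀ x : Fin (n + 1), x ≠ 0 → StrictMono ![0, x] := by
    intro x hx
    rw [Fin.strictMono_iff_lt_succ]
    intro p
    fin_cases p
    simpa using Fin.pos_of_ne_zero hx
  have h2 := hA 2 ![0, i] ![0, j] (mono i fun hc => hi (hc ▸ h0)) (mono j fun hc => hj (hc ▸ h0))
  rw [det_fin_two] at h2
  simp only [submatrix_apply, cons_val_zero, cons_val_one, h0] at h2
  have := mul_pos ((hA.apply_nonneg 0 j).lt_of_ne' hj) ((hA.apply_nonneg i 0).lt_of_ne' hi)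
  linarith

theorem MinorsNonneg.det_castSucc_pos {n : ℕ} {A : Matrix (Fin (n + 1)) (Fin (n + 1)) ℝ}
    (hA : MinorsNonneg A) (h : 0 < A.det) :
    0 < (A.submatrix Fin.castSucc Fin.castSucc).det := by
  induction n with
  | zero => simp
  | succ n ih =>
    have h0 := hA.zero_zero_pos h
    rw [det_eq_mul_det_schurCompl _ h0.ne'] at h
    rw [det_eq_mul_det_schurCompl _ (by simpa using h0.ne')]
    exact mul_pos h0 (ih (hA.schurCompl h0) (pos_of_mul_pos_right h h0.le))

theorem MinorsNonneg.det_succ_pos {n : ℕ} {A : Matrix (Fin (n + 1)) (Fin (n + 1)) ℝ}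
    (hA : MinorsNonneg A) (h : 0 < A.det) :
    0 < (A.submatrix Fin.succ Fin.succ).det := by
  have h1 := hA.rev.det_castSucc_pos 
    (h.trans_eq (det_submatrix_equiv_self Fin.revPerm A).symm)
  rw [← det_submatrix_rev] at h1
  convert h1 using 2
  ext i j
  simp [Fin.rev_castSucc]

/-- Principal minors on a window of consecutive indices of a nonsingular matrix with nonnegative
minors are positive. -/
theorem MinorsNonneg.det_window_pos {n : ℕ} {A : Matrix (Fin n) (Fin n) ℝ}
    (hA : MinorsNonneg A) (h : 0 < A.det) (i k : ℕ) (hik : i + k ≤ n) :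
    0 < (A.submatrix (fun p : Fin k => (⟨i + p, by omega⟩ : Fin n))
      (fun p : Fin k => (⟨i + p, by omega⟩ : Fin n))).det := by
  induction n generalizing i with
  | zero =>
    obtain rfl : k = 0 := by omega
    simp
  | succ n ih =>
    rcases Nat.lt_or_ge (i + k) (n + 1) with hlt | hge
    · exact ih (hA.submatrix Fin.strictMono_castSucc Fin.strictMono_castSucc)
        (hA.det_castSucc_pos h) i (by omega)
    · cases i with
      | zero =>
        obtain rfl : k = n + 1 := by omega
        simp only [zero_add]
        exact h
      | succ i =>
        have h1 := ih (hA.submatrix Fin.strictMono_succ Fin.strictMono_succ)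
          (hA.det_succ_pos h) i (by omega)
        convert h1 using 2
        ext a b
        simp [Nat.add_right_comm]

/-- The linear relation between the rows of an `(n + 1) × n` matrix given by its maximal minors. -/
theorem sum_det_succAbove_mul_eq_zero {n : ℕ} (M : Matrix (Fin (n + 1)) (Fin n) ℝ) (j : Fin n) :
    ∑ q : Fin (n + 1), (-1) ^ (q : ℕ) * (M.submatrix q.succAbove id).det * M q j = 0 := by
  have h : (Matrix.of fun i => (Fin.cons (M i j) (M i) : Fin (n + 1) → ℝ)).det = 0 :=
    det_zero_of_column_eq (Fin.succ_ne_zero j).symm (by simp)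
  rw [det_succ_column_zero] at h
  rw [← h]
  refine Finset.sum_congr rfl fun q _ => ?_
  have : ((Matrix.of fun i => (Fin.cons (M i j) (M i) : Fin (n + 1) → ℝ)).submatrix
      q.succAbove Fin.succ) = M.submatrix q.succAbove id := by
    ext; simp
  rw [this]
  simp only [of_apply, Fin.cons_zero]
  ring

/-- A linear relation between the rows of an `(n + 1) × n` matrix whose last `n` rows are
independent is a multiple of the one given by the maximal minors. -/
theorem mul_det_eq_of_relation {n : ℕ} (M : Matrix (Fin (n + 1)) (Fin n) ℝ)
    (h : (M.submatrix Fin.succ id).det ≠ 0) (c : Fin (n + 1) → ℝ)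
    (hc : ∀ j, ∑ i, c i * M i j = 0) (p : Fin (n + 1)) :
    c p * (M.submatrix Fin.succ id).det =
      c 0 * ((-1) ^ (p : ℕ) * (M.submatrix p.succAbove id).det) := by
  set e : Fin (n + 1) → ℝ := fun p => (-1) ^ (p : ℕ) * (M.submatrix p.succAbove id).det with he
  have he0 : e 0 = (M.submatrix Fin.succ id).det := by simp [he]
  have hker : (fun i : Fin n => c i.succ * e 0 - c 0 * e i.succ) = 0 := by
    refine eq_zero_of_vecMul_eq_zero h (funext fun j => ?_)
    have h1 := hc j
    have h2 := sum_det_succAbove_mul_eq_zero M j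
    change ∑ q, e q * M q j = 0 at h2
    rw [Fin.sum_univ_succ] at h1 h2
    simp only [vecMul, dotProduct, submatrix_apply, id_eq, Pi.zero_apply, sub_mul,
      Finset.sum_sub_distrib]
    have h3 : ∑ i : Fin n, c i.succ * e 0 * M i.succ j
        = e 0 * ∑ i : Fin n, c i.succ * M i.succ j := by
      rw [Finset.mul_sum]; exact Finset.sum_congr rfl fun _ _ => by ring
    have h4 : ∑ i : Fin n, c 0 * e i.succ * M i.succ j
        = c 0 * ∑ i : Fin n, e i.succ * M i.succ j := by
      rw [Finset.mul_sum]; exact Finset.sum_congr rfl fun _ _ => by ring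
    rw [h3, h4]
    linear_combination e 0 * h1 - c 0 * h2
  rw [← he0]
  cases p using Fin.cases with
  | zero => rfl
  | succ i => exact sub_eq_zero.1 (congrFun hker i)

theorem det_succAbove_ne_zero {k : ℕ} (M : Matrix (Fin (k + 2)) (Fin (k + 1)) ℝ)
    (q : Fin (k + 2)) (hq0 : q ≠ 0) (hql : q ≠ Fin.last (k + 1))
    (hfirst : 0 ≤ (M.submatrix Fin.succ id).det)
    (hlast : 0 < (M.submatrix Fin.castSucc id).det)
    (hfirst' : 0 < (M.submatrix (fun p => q.succAbove (Fin.succ p)) Fin.succ).det)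
    (hlast' : 0 ≤ (M.submatrix (fun p => q.succAbove (Fin.castSucc p)) Fin.succ).det) :
    (M.submatrix q.succAbove id).det ≠ 0 := by
  intro h
  have key := mul_det_eq_of_relation (M.submatrix q.succAbove Fin.succ) hfirst'.ne'
    (fun p => (-1) ^ (q.succAbove p : ℕ) * (M.submatrix (q.succAbove p).succAbove id).det)
    (fun j => by
      have h1 := sum_det_succAbove_mul_eq_zero M j.succ
      rw [Fin.sum_univ_succAbove _ q, h] at h1
      simpa using h1) (Fin.last k)
  rw [Fin.succAbove_ne_zero_zero hq0, Fin.succAbove_ne_last_last hql, Fin.succAbove_last,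
    Fin.succAbove_last, Fin.succAbove_zero] at key
  change _ * (M.submatrix (fun p => q.succAbove (Fin.succ p)) Fin.succ).det = _ * (_ *
    (M.submatrix (fun p => q.succAbove (Fin.castSucc p)) Fin.succ).det) at key
  simp only [Fin.val_last, Fin.val_zero, pow_zero, one_mul, pow_succ] at key
  have hsq : ((-1 : ℝ) ^ k) * (-1) ^ k = 1 := by
    rw [← mul_pow]; simp
  have := mul_pos hlast hfirst'
  have := mul_nonneg hfirst hlast'
  have e1 : (M.submatrix Fin.castSucc id).det *
      (M.submatrix (fun p => q.succAbove (Fin.succ p)) Fin.succ).det =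
      - ((M.submatrix Fin.succ id).det *
      (M.submatrix (fun p => q.succAbove (Fin.castSucc p)) Fin.succ).det) := by
    linear_combination (-(-1 : ℝ) ^ k) * key - ((M.submatrix Fin.castSucc id).det *
      (M.submatrix (fun p => q.succAbove (Fin.succ p)) Fin.succ).det +
      (M.submatrix Fin.succ id).det *
      (M.submatrix (fun p => q.succAbove (Fin.castSucc p)) Fin.succ).det) * hsq
  linarith

theorem exists_gap_of_not_consecutive {d k : ℕ} {I : Fin (k + 1) → Fin d} (hI : StrictMono I)
    (h : ¬ Consecutive I) : ∃ p : Fin k, (I p.castSucc : ℕ) + 1 < I p.succ := by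
  by_contra! hc
  have hp : ∀ p, (I p : ℕ) = I 0 + p := by
    intro p
    induction p using Fin.induction with
    | zero => simp
    | succ p ih =>
      have h1 := hc p
      have h2 : (I p.castSucc : ℕ) < I p.succ := hI p.castSucc_lt_succ
      simp only [Fin.val_succ, Fin.val_castSucc] at *
      omega
  exact h fun p q => by rw [hp p, hp q]; omega

/-- Adding a row in a gap to an increasing tuple of rows. -/
theorem exists_strictMono_succAbove {d k : ℕ} {I : Fin (k + 1) → Fin d} (hI : StrictMono I)
    {p : Fin k} (hp : (I p.castSucc : ℕ) + 1 < I p.succ) :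
    ∃ (K : Fin (k + 2) → Fin d) (q : Fin (k + 2)), StrictMono K ∧ q ≠ 0 ∧ q ≠ Fin.last (k + 1) ∧
      (∀ i, K (q.succAbove i) = I i) ∧ (∀ i, K i.castSucc ≤ I i) ∧
      ∃ i, K i.castSucc < I i := by
  let r : Fin d := ⟨I p.castSucc + 1, hp.trans (I p.succ).isLt⟩
  let q : Fin (k + 2) := p.succ.castSucc
  have hKq : (q.insertNth r I : Fin (k + 2) → Fin d) q = r := Fin.insertNth_apply_same _ _ _
  have hK : ∀ i, (q.insertNth r I : Fin (k + 2) → Fin d) (q.succAbove i) = I i :=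
    fun i => Fin.insertNth_apply_succAbove _ _ _ _
  have hmono : StrictMono (q.insertNth r I : Fin (k + 2) → Fin d) := by
    have hlow : ∀ i : Fin (k + 1), i.castSucc < q → I i < r := by
      intro i hi
      have : I i ≤ I p.castSucc := hI.monotone (by
        simp only [q, Fin.lt_def, Fin.le_def, Fin.val_castSucc, Fin.val_succ] at *; omega)
      simp only [r, Fin.lt_def, Fin.le_def] at *
      omega
    have hhigh : ∀ i : Fin (k + 1), q ≤ i.castSucc → r < I i := by
      intro i hi
      have : I p.succ ≤ I i := hI.monotone (by
        simp only [q, Fin.le_def, Fin.val_castSucc, Fin.val_succ] at *; omega)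
      simp only [r, Fin.lt_def, Fin.le_def] at *
      omega
    intro a b hab
    rcases Fin.eq_self_or_eq_succAbove q a with rfl | ⟨a', rfl⟩ <;>
    rcases Fin.eq_self_or_eq_succAbove q b with hb | ⟨b', rfl⟩
    · exact absurd hab (by rw [hb]; exact lt_irrefl _)
    · rw [hKq, hK]
      exact hhigh _ (Fin.lt_succAbove_iff_le_castSucc _ _ |>.1 hab)
    · rw [hb, hKq, hK]
      exact hlow _ (Fin.succAbove_lt_iff_castSucc_lt _ _ |>.1 (hb ▸ hab))
    · rw [hK, hK]
      exact hI (Fin.succAbove_lt_succAbove_iff.1 hab)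
  refine ⟨q.insertNth r I, q, hmono, by simp [q, Fin.ext_iff], ?_, hK, fun i => ?_, p.succ, ?_⟩
  · have := p.isLt
    simp only [q, ne_eq, Fin.ext_iff, Fin.val_castSucc, Fin.val_succ, Fin.val_last]
    omega
  · rw [← hK i]
    refine hmono.monotone ?_
    simp only [Fin.succAbove]
    split_ifs
    · exact le_rfl
    · exact (Fin.castSucc_lt_succ).le
  · change (q.insertNth r I : Fin (k + 2) → Fin d) q < _
    rw [hKq]
    exact hp

/-- If the nontrivial minors with consecutive rows are positive, then so are all of them; the
columns are only assumed to range over a class stable under deleting the first column. -/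
theorem MinorsNonneg.det_pos_of_consecutive_rows {d : ℕ} {A : Matrix (Fin d) (Fin d) ℝ}
    (hA : MinorsNonneg A) (Q : ∀ k : ℕ, (Fin k → Fin d) → Prop)
    (hQ : ∀ k J, Q (k + 1) J → Q k fun p => J p.succ)
    (hcons : ∀ (k : ℕ) (I J : Fin k → Fin d), StrictMono I → StrictMono J → (∀ p, I p ≤ J p) →
      Consecutive I → Q k J → 0 < (A.submatrix I J).det)
    (k : ℕ) (I J : Fin k → Fin d) (hI : StrictMono I) (hJ : StrictMono J)
    (hIJ : ∀ p, I p ≤ J p) (hQJ : Q k J) : 0 < (A.submatrix I J).det := by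
  induction k with
  | zero => simp
  | succ k ihk =>
    induction hs : ∑ p, (I p : ℕ) using Nat.strong_induction_on generalizing I with
    | _ s ihs =>
    by_cases hc : Consecutive I
    · exact hcons _ I J hI hJ hIJ hc hQJ
    obtain ⟨p, hp⟩ := exists_gap_of_not_consecutive hI hc
    obtain ⟨K, q, hK, hq0, hql, hKI, hle, i, hlt⟩ := exists_strictMono_succAbove hI hp
    have hJs : StrictMono fun p : Fin k => J p.succ := hJ.comp Fin.strictMono_succ
    have hlast := ihs (∑ p : Fin (k + 1), (K p.castSucc : ℕ))
      (hs ▸ Finset.sum_lt_sum (fun j _ => hle j) ⟨i, Finset.mem_univ _, hlt⟩)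
      (fun p => K p.castSucc) (hK.comp Fin.strictMono_castSucc)
      (fun p => (hle p).trans (hIJ p)) rfl
    have hfirst' := ihk (fun p => I p.succ) (fun p => J p.succ)
      (hI.comp Fin.strictMono_succ) hJs (fun p => hIJ _) (hQ _ _ hQJ)
    have hlast' := hA k (fun p => I p.castSucc) (fun p => J p.succ)
      (hI.comp Fin.strictMono_castSucc) hJs
    have hfirst := hA (k + 1) (fun p => K p.succ) J (hK.comp Fin.strictMono_succ) hJ
    have key := det_succAbove_ne_zero (A.submatrix K J) q hq0 hql hfirst hlast
      (by simpa only [submatrix_submatrix, Function.comp_def, hKI] using hfirst')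
      (by simpa only [submatrix_submatrix, Function.comp_def, hKI] using hlast')
    simp only [submatrix_submatrix, Function.comp_def, hKI, id] at key
    exact (hA _ I J hI hJ).lt_of_ne' key

theorem antitranspose_submatrix_det {d k : ℕ} (A : Matrix (Fin d) (Fin d) ℝ)
    (I J : Fin k → Fin d) :
    (((A.submatrix Fin.rev Fin.rev)ᵀ).submatrix I J).det =
      (A.submatrix (fun p : Fin k => (J p.rev).rev) (fun p : Fin k => (I p.rev).rev)).det := by
  rw [det_submatrix_rev A (fun p => (J p).rev) (fun p => (I p).rev), ← det_transpose]
  rfl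

theorem MinorsNonneg.antitranspose {d : ℕ} {A : Matrix (Fin d) (Fin d) ℝ}
    (hA : MinorsNonneg A) : MinorsNonneg (A.submatrix Fin.rev Fin.rev)ᵀ := by
  intro k I J hI hJ
  rw [antitranspose_submatrix_det]
  exact hA _ _ _ (strictMono_rev_comp_rev hJ) (strictMono_rev_comp_rev hI)

theorem Consecutive.rev {d k : ℕ} {I : Fin k → Fin d} (hI : Consecutive I) :
    Consecutive fun p => (I p.rev).rev := by
  intro p q
  have := hI p.rev q.rev
  have := (I p.rev).isLt
  have := (I q.rev).isLt
  simp only [Fin.val_rev] at *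
  omega

/-- If the nontrivial minors with consecutive rows and columns are positive, then so are all
nontrivial minors. -/
theorem MinorsNonneg.det_pos_of_consecutive {d : ℕ} {A : Matrix (Fin d) (Fin d) ℝ}
    (hA : MinorsNonneg A)
    (hcons : ∀ (k : ℕ) (I J : Fin k → Fin d), StrictMono I → StrictMono J → (∀ p, I p ≤ J p) →
      Consecutive I → Consecutive J → 0 < (A.submatrix I J).det)
    (k : ℕ) (I J : Fin k → Fin d) (hI : StrictMono I) (hJ : StrictMono J)
    (hIJ : ∀ p, I p ≤ J p) : 0 < (A.submatrix I J).det := by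
  have hcols := hA.det_pos_of_consecutive_rows (fun k J => Consecutive J)
    (fun k J h p q => by have := h p.succ q.succ; simp only [Fin.val_succ] at *; omega) hcons
  have h := hA.antitranspose.det_pos_of_consecutive_rows (fun _ _ => True) (fun _ _ _ => trivial)
    (fun k I J hI hJ hIJ hc _ => by
      rw [antitranspose_submatrix_det]
      exact hcols k _ _ (strictMono_rev_comp_rev hJ) (strictMono_rev_comp_rev hI)
        (fun p => Fin.rev_le_rev.2 (hIJ _)) hc.rev)
    k _ _ (strictMono_rev_comp_rev hJ) (strictMono_rev_comp_rev hI)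
    (fun p => Fin.rev_le_rev.2 (hIJ _)) trivial
  rw [antitranspose_submatrix_det] at h
  simpa only [Fin.rev_rev] using h

/-- The trivial minors of an upper triangular matrix vanish. -/
theorem det_submatrix_eq_zero_of_lt {d k : ℕ} {u : Matrix (Fin d) (Fin d) ℝ}
    (hu : ∀ i j : Fin d, (j : ℕ) < (i : ℕ) → u i j = 0) {I J : Fin k → Fin d}
    (hI : StrictMono I) (hJ : StrictMono J) {p : Fin k} (hp : J p < I p) :
    (u.submatrix I J).det = 0 := by
  rw [det_apply]
  refine Finset.sum_eq_zero fun σ _ => ?_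
  obtain ⟨i, hi, hσ⟩ : ∃ i, i ≤ p ∧ p ≤ σ i := by
    by_contra! hc
    have h := Finset.card_le_card_of_injOn σ
      (s := Finset.Iic p) (t := Finset.Iio p) (fun i hi => by simpa using hc i (by simpa using hi))
      σ.injective.injOn
    simp at h
  rw [Finset.prod_eq_zero (Finset.mem_univ i), smul_zero]
  exact hu _ _ (((hJ.monotone hi).trans_lt hp).trans_le (hI.monotone hσ))

theorem TotallyNonneg.minorsNonneg {d : ℕ} {u : Matrix (Fin d) (Fin d) ℝ}
    (hnn : TotallyNonneg u) (hu : UTUnipotent u) : MinorsNonneg u := by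
  intro k I J hI hJ
  rcases Nat.eq_zero_or_pos k with rfl | hk
  · simp
  by_cases h : ∀ p, I p ≤ J p
  · exact hnn k hk (by simpa using Fintype.card_le_of_injective I hI.injective) I J hI hJ h
  · push Not at h
    obtain ⟨p, hp⟩ := h
    exact (det_submatrix_eq_zero_of_lt hu.1 hI hJ hp).ge

theorem UTUnipotent.det_eq_one {d : ℕ} {u : Matrix (Fin d) (Fin d) ℝ} (hu : UTUnipotent u) :
    u.det = 1 := by
  rw [det_of_isUpperTriangular fun i j h => hu.1 i j h]
  exact Finset.prod_eq_one fun i _ => hu.2 i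

theorem strictMono_cornerI {d k : ℕ} (hk : k ≤ d) : StrictMono (cornerI k hk) := fun _ _ h => h

theorem strictMono_cornerJ {d k : ℕ} (hk : k ≤ d) : StrictMono (cornerJ k hk) :=
  fun _ _ h => Nat.add_lt_add_left h _

/-- If the corner minors are positive, so are the nontrivial minors with consecutive rows and
columns. -/
theorem MinorsNonneg.det_pos_of_corner {d : ℕ} {A : Matrix (Fin d) (Fin d) ℝ}
    (hA : MinorsNonneg A)
    (hc : ∀ (k : ℕ) (hk : k ≤ d), 0 < (A.submatrix (cornerI k hk) (cornerJ k hk)).det)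
    (k : ℕ) (I J : Fin k → Fin d) (hIJ : ∀ p, I p ≤ J p)
    (hI : Consecutive I) (hJ : Consecutive J) : 0 < (A.submatrix I J).det := by
  cases k with
  | zero => simp
  | succ k =>
    have h0 : (I 0 : ℕ) ≤ J 0 := hIJ 0
    have hJl := hJ 0 (Fin.last k)
    have hJd := (J (Fin.last k)).isLt
    simp only [Fin.val_last, Fin.val_zero] at hJl
    have hK : d - (J 0 - I 0) ≤ d := Nat.sub_le _ _
    have h := (hA.submatrix (strictMono_cornerI hK) (strictMono_cornerJ hK)).det_window_pos
      (hc _ hK) (I 0) (k + 1) (by omega)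
    convert h using 2
    ext a b
    have ha := hI 0 a
    have hb := hJ 0 b
    simp only [Fin.val_zero] at ha hb
    simp only [submatrix_apply, cornerI, cornerJ]
    congr 1 <;> ext <;> simp only <;> omega

/-- A totally nonnegative upper triangular unipotent matrix
that is not totally positive has a vanishing top-right corner `k × k` minor for
some `1 ≤ k ≤ d - 1`. -/
theorem exists_corner_minor_eq_zero {d : ℕ}
    (u : Matrix (Fin d) (Fin d) ℝ) (hu : UTUnipotent u) (hnn : TotallyNonneg u)
    (hnp : ¬ TotallyPositive u) :
    ∃ (k : ℕ) (_ : 1 ≤ k) (h2 : k ≤ d - 1),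
      (u.submatrix (cornerI k (by omega)) (cornerJ k (by omega))).det = 0 := by
  by_contra! hne
  have hA := hnn.minorsNonneg hu
  refine hnp fun k _ _ I J hI hJ hIJ => hA.det_pos_of_consecutive
    (fun k I J _ _ hIJ hcI hcJ => hA.det_pos_of_corner (fun k hk => ?_) k I J hIJ hcI hcJ)
    k I J hI hJ hIJ
  rcases Nat.eq_zero_or_pos k with rfl | hk1
  · simp
  rcases hk.eq_or_lt with rfl | hlt
  · have hI : cornerI k hk = id := rfl
    have hJ : cornerJ k hk = id := by
      ext p
      simp [cornerJ]
    rw [hI, hJ, submatrix_id_id, hu.det_eq_one]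
    exact one_pos
  · exact (hA _ _ _ (strictMono_cornerI hk) (strictMono_cornerJ hk)).lt_of_ne'
      (hne k hk1 (by omega))
end

section
/- Let v and v′ be any d×d real upper triangular unipotent matrices, and let Q_d be the d-th upper triangular Pascal matrix. Then there exists T such that for every natural number t ≥ T, the product v′·(Q_d)^t·v is totally positive. -/
open Matrix

open Filter Topology

/-- The matrix of binomial coefficients `C(J q, I p)`. -/
def chooseMatrix {k : ℕ} (I J : Fin k → ℕ) : Matrix (Fin k) (Fin k) ℝ :=
  Matrix.of fun p q => ((J q).choose (I p) : ℝ)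

/-- Pascal's rule, applied to all rows simultaneously. -/
theorem det_chooseMatrix_add_one {k : ℕ} (I J : Fin k → ℕ) :
    (chooseMatrix I fun q => J q + 1).det =
      ∑ s : Finset (Fin k), if ∀ p ∈ s, I p ≠ 0 then
        (chooseMatrix (fun p => if p ∈ s then I p - 1 else I p) J).det else 0 := by
  have hrow : (chooseMatrix I fun q => J q + 1) =
      (fun p q => if I p = 0 then (0 : ℝ) else ((J q).choose (I p - 1) : ℝ)) +
        (fun p q => ((J q).choose (I p) : ℝ)) := by
    ext p q
    simp only [chooseMatrix, Matrix.of_apply, Pi.add_apply]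
    rcases h : I p with _ | n
    · simp
    · simp [Nat.choose_succ_succ]
  have hexp := (Matrix.detRowAlternating (n := Fin k) (R := ℝ)).toMultilinearMap.map_add_univ
    (fun p q => if I p = 0 then (0 : ℝ) else ((J q).choose (I p - 1) : ℝ))
    (fun p q => ((J q).choose (I p) : ℝ))
  rw [hrow]
  refine hexp.trans (Finset.sum_congr rfl fun s _ => ?_)
  split_ifs with h
  · change Matrix.det _ = _
    congr 1
    ext p q
    by_cases hp : p ∈ s
    · simp [chooseMatrix, hp, h p hp]
    · simp [chooseMatrix, hp]
  · push Not at h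
    obtain ⟨p, hp, h0⟩ := h
    refine MultilinearMap.map_coord_zero _ p ?_
    ext q
    simp [hp, h0]

theorem det_chooseMatrix_of_not_injective {k : ℕ} {I : Fin k → ℕ} (J : Fin k → ℕ)
    (hI : ¬ Function.Injective I) : (chooseMatrix I J).det = 0 := by
  simp only [Function.Injective, not_forall] at hI
  obtain ⟨a, b, hab, hne⟩ := hI
  exact Matrix.det_zero_of_row_eq hne (by ext q; simp [chooseMatrix, hab])

theorem monotone_ite_sub_one {k : ℕ} {I : Fin k → ℕ} (hI : StrictMono I) (s : Finset (Fin k)) :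
    Monotone fun p => if p ∈ s then I p - 1 else I p := by
  intro a b hab
  rcases hab.eq_or_lt with rfl | h
  · rfl
  · have := hI h
    dsimp only
    split_ifs <;> omega

theorem det_chooseMatrix_of_zero {k : ℕ} {I J : Fin (k + 1) → ℕ} (hJ : J 0 = 0)
    (hI : StrictMono I) :
    (chooseMatrix I J).det = if I 0 = 0 then
      (chooseMatrix (fun p => I p.succ) fun q => J q.succ).det else 0 := by
  have hpos : ∀ p : Fin k, I p.succ ≠ 0 := fun p =>
    ((Nat.zero_le _).trans_lt (hI (Fin.succ_pos p))).ne'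
  rw [Matrix.det_succ_column_zero, Fin.sum_univ_succ]
  have hz : ∀ p : Fin k, chooseMatrix I J p.succ 0 = 0 := fun p => by
    simp [chooseMatrix, hJ, Nat.choose_eq_zero_of_lt (Nat.pos_of_ne_zero (hpos p))]
  simp only [hz, mul_zero, zero_mul, Finset.sum_const_zero, add_zero]
  split_ifs with h
  · have h1 : chooseMatrix I J 0 0 = 1 := by simp [chooseMatrix, hJ, h]
    rw [h1, Fin.val_zero, pow_zero, one_mul, one_mul]
    rfl
  · have h1 : chooseMatrix I J 0 0 = 0 := by
      simp [chooseMatrix, hJ, Nat.choose_eq_zero_of_lt (Nat.pos_of_ne_zero h)]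
    rw [h1]
    simp

/-- Minors of the infinite Pascal matrix are nonnegative, and the non-trivial ones are positive. -/
theorem det_chooseMatrix_nonneg_and_pos (k : ℕ) :
    ∀ I J : Fin k → ℕ, StrictMono I → StrictMono J →
      0 ≤ (chooseMatrix I J).det ∧ ((∀ p, I p ≤ J p) → 0 < (chooseMatrix I J).det) := by
  induction k with
  | zero => intro I J _ _; simp
  | succ k ihk =>
    intro I J hI hJ
    induction hm : J 0 generalizing I J with
    | zero =>
      rw [det_chooseMatrix_of_zero hm hI]
      have ih := ihk (fun p => I p.succ) (fun q => J q.succ)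
        (hI.comp (Fin.strictMono_succ)) (hJ.comp (Fin.strictMono_succ))
      split_ifs with h
      · exact ⟨ih.1, fun hle => ih.2 fun p => hle _⟩
      · exact ⟨le_rfl, fun hle => absurd (hle 0) (by omega)⟩
    | succ m ihm =>
      have hJpos : ∀ q, 1 ≤ J q := fun q => by
        have := hJ.monotone (Fin.zero_le q)
        omega
      obtain ⟨J', rfl⟩ : ∃ J' : Fin (k + 1) → ℕ, J = fun q => J' q + 1 :=
        ⟨fun q => J q - 1, funext fun q => (Nat.sub_add_cancel (hJpos q)).symm⟩
      have hJ' : StrictMono J' := fun a b hab => by simpa using hJ hab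
      have hm' : J' 0 = m := by simpa using hm
      rw [det_chooseMatrix_add_one]
      have hterm : ∀ s : Finset (Fin (k + 1)), 0 ≤ if ∀ p ∈ s, I p ≠ 0 then
          (chooseMatrix (fun p => if p ∈ s then I p - 1 else I p) J').det else 0 := by
        intro s
        split_ifs with h
        · by_cases hinj : Function.Injective fun p => if p ∈ s then I p - 1 else I p
          · exact (ihm _ J' ((monotone_ite_sub_one hI s).strictMono_of_injective hinj) hJ' hm').1
          · rw [det_chooseMatrix_of_not_injective J' hinj]
        · exact le_rfl
      refine ⟨Finset.sum_nonneg fun s _ => hterm s, fun hle => ?_⟩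
      refine Finset.sum_pos' (fun s _ => hterm s)
        ⟨Finset.univ.filter fun p => I p = J' p + 1, Finset.mem_univ _, ?_⟩
      rw [if_pos (by simp +contextual)]
      refine (ihm _ J' ?_ hJ' hm').2 fun p => ?_
      · intro a b hab
        have h1 := hI hab
        have h2 := hJ' hab
        have h3 : I a ≤ J' a + 1 := hle a
        have h4 : I b ≤ J' b + 1 := hle b
        simp only [Finset.mem_filter, Finset.mem_univ, true_and]
        split_ifs <;> omega
      · have : I p ≤ J' p + 1 := hle p
        simp only [Finset.mem_filter, Finset.mem_univ, true_and]
        split_ifs <;> omega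

theorem pascal_apply {d : ℕ} (i j : Fin d) : pascal d i j = ((j : ℕ).choose i : ℝ) := by
  simp only [pascal, Matrix.of_apply]
  split_ifs with h
  · rfl
  · rw [Nat.choose_eq_zero_of_lt (not_le.1 h), Nat.cast_zero]

theorem totallyPositive_pascal (d : ℕ) : TotallyPositive (pascal d) := by
  intro k _ _ I J hI hJ hIJ
  have h : (pascal d).submatrix I J =
      chooseMatrix (fun p => (I p : ℕ)) fun q => (J q : ℕ) := by
    ext p q
    exact pascal_apply _ _
  rw [h]
  exact (det_chooseMatrix_nonneg_and_pos k _ _ hI hJ).2 hIJ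

theorem pascal_pow_apply {d : ℕ} (t : ℕ) (i j : Fin d) :
    (pascal d ^ t) i j = ((j : ℕ).choose i : ℝ) * (t : ℝ) ^ ((j : ℕ) - i) := by
  induction t generalizing i j with
  | zero =>
    rcases lt_trichotomy i j with h | rfl | h
    · have : (j : ℕ) - i ≠ 0 := by have : (i : ℕ) < j := h; omega
      simp [Matrix.one_apply_ne h.ne, this]
    · simp
    · simp [Matrix.one_apply_ne h.ne', Nat.choose_eq_zero_of_lt (show (j : ℕ) < i from h)]
  | succ t ih =>
    rw [pow_succ, Matrix.mul_apply]
    simp only [ih, pascal_apply]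
    rw [Fin.sum_univ_eq_sum_range (fun a => ((a.choose i : ℝ) * (t : ℝ) ^ (a - i)) *
      ((j : ℕ).choose a : ℝ)) d]
    rcases lt_or_ge (j : ℕ) i with hji | hij
    · rw [Nat.choose_eq_zero_of_lt hji, Nat.cast_zero, zero_mul]
      refine Finset.sum_eq_zero fun a _ => ?_
      rcases lt_or_ge a (i : ℕ) with h | h
      · simp [Nat.choose_eq_zero_of_lt h]
      · simp [Nat.choose_eq_zero_of_lt (hji.trans_le h)]
    · have hsub : Finset.Ico (i : ℕ) (j + 1) ⊆ Finset.range d := fun a ha => by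
        have := j.isLt
        simp only [Finset.mem_Ico, Finset.mem_range] at ha ⊢
        omega
      rw [← Finset.sum_subset hsub, Finset.sum_Ico_eq_sum_range, Nat.cast_add, Nat.cast_one,
        add_pow, Finset.mul_sum, Nat.sub_add_comm hij]
      · refine Finset.sum_congr rfl fun a _ => ?_
        have hc := Nat.choose_mul (n := j) (Nat.le_add_right (i : ℕ) a)
        rw [Nat.add_sub_cancel_left] at hc
        have hc' : (((j : ℕ).choose (i + a) : ℝ)) * ((i + a : ℕ).choose i : ℝ) =
            ((j : ℕ).choose i : ℝ) * (((j : ℕ) - i).choose a : ℝ) := by exact_mod_cast hc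
        rw [Nat.add_sub_cancel_left, one_pow]
        linear_combination (t : ℝ) ^ a * hc'
      · intro a _ ha
        simp only [Finset.mem_Ico, not_and_or, not_le, not_lt] at ha
        rcases ha with h | h
        · simp [Nat.choose_eq_zero_of_lt h]
        · simp [Nat.choose_eq_zero_of_lt (show (j : ℕ) < a by omega)]

/-- The conjugate of `u` by the diagonal matrix with entries `x ^ i`. -/
noncomputable def diagConj {d : ℕ} (x : ℝ) (u : Matrix (Fin d) (Fin d) ℝ) : Matrix (Fin d) (Fin d) ℝ :=
  Matrix.of fun i j => x ^ (i : ℕ) * u i j * (x ^ (j : ℕ))⁻¹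

theorem diagConj_mul {d : ℕ} {x : ℝ} (hx : x ≠ 0) (u w : Matrix (Fin d) (Fin d) ℝ) :
    diagConj x (u * w) = diagConj x u * diagConj x w := by
  ext i j
  simp only [diagConj, Matrix.of_apply, Matrix.mul_apply, Finset.mul_sum, Finset.sum_mul]
  refine Finset.sum_congr rfl fun a _ => ?_
  field_simp

theorem diagConj_pascal_pow {d t : ℕ} (ht : t ≠ 0) :
    diagConj (t : ℝ) (pascal d ^ t) = pascal d := by
  have ht' : (t : ℝ) ≠ 0 := Nat.cast_ne_zero.2 ht
  ext i j
  rw [diagConj, Matrix.of_apply, pascal_pow_apply, pascal_apply]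
  rcases lt_or_ge (j : ℕ) i with h | h
  · simp [Nat.choose_eq_zero_of_lt h]
  · have hp : (t : ℝ) ^ (j : ℕ) = (t : ℝ) ^ (i : ℕ) * (t : ℝ) ^ ((j : ℕ) - i) := by
      rw [← pow_add, Nat.add_sub_cancel' h]
    rw [hp]
    field_simp

theorem det_submatrix_pos_of_diagConj {d k : ℕ} {x : ℝ} (hx : 0 < x)
    {u : Matrix (Fin d) (Fin d) ℝ} {I J : Fin k → Fin d}
    (h : 0 < ((diagConj x u).submatrix I J).det) : 0 < (u.submatrix I J).det := by
  have heq : (diagConj x u).submatrix I J = Matrix.of fun p q => (x ^ (J q : ℕ))⁻¹ *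
      (Matrix.of fun p q => x ^ (I p : ℕ) * u.submatrix I J p q) p q := by
    ext p q
    simp only [diagConj, Matrix.submatrix_apply, Matrix.of_apply]
    ring
  rw [heq, Matrix.det_mul_row, Matrix.det_mul_column] at h
  exact pos_of_mul_pos_right (pos_of_mul_pos_right h (by positivity)) (by positivity)

theorem tendsto_diagConj_atTop {d : ℕ} {u : Matrix (Fin d) (Fin d) ℝ} (hu : UTUnipotent u) :
    Tendsto (fun t : ℕ => diagConj (t : ℝ) u) atTop (𝓝 1) := by
  refine tendsto_pi_nhds.2 fun i => tendsto_pi_nhds.2 fun j => ?_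
  simp only [diagConj, Matrix.of_apply]
  rcases lt_trichotomy i j with h | rfl | h
  · rw [Matrix.one_apply_ne h.ne]
    have hij : (i : ℕ) < j := h
    have hlim : Tendsto (fun t : ℕ => u i j * ((t : ℝ) ^ ((j : ℕ) - i))⁻¹) atTop
        (𝓝 (u i j * 0)) :=
      (((tendsto_pow_atTop (by omega)).comp tendsto_natCast_atTop_atTop).inv_tendsto_atTop).const_mul
        _
    rw [mul_zero] at hlim
    refine hlim.congr' ((eventually_gt_atTop 0).mono fun t ht => ?_)
    have ht' : (t : ℝ) ≠ 0 := Nat.cast_ne_zero.2 ht.ne'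
    have hp : (t : ℝ) ^ (j : ℕ) = (t : ℝ) ^ (i : ℕ) * (t : ℝ) ^ ((j : ℕ) - i) := by
      rw [← pow_add, Nat.add_sub_cancel' hij.le]
    beta_reduce
    rw [hp]
    field_simp
  · rw [Matrix.one_apply_eq]
    refine tendsto_const_nhds.congr' ((eventually_gt_atTop 0).mono fun t ht => ?_)
    have ht' : (t : ℝ) ≠ 0 := Nat.cast_ne_zero.2 ht.ne'
    beta_reduce
    rw [hu.2 i, mul_one, mul_inv_cancel₀ (pow_ne_zero _ ht')]
  · simp [Matrix.one_apply_ne h.ne', hu.1 i j h]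

theorem TotallyPositive.eventually_of_tendsto {d : ℕ} {w : Matrix (Fin d) (Fin d) ℝ}
    (hw : TotallyPositive w) {α : Type*} {l : Filter α} {f : α → Matrix (Fin d) (Fin d) ℝ}
    (hf : Tendsto f l (𝓝 w)) : ∀ᶠ t in l, TotallyPositive (f t) := by
  have h : ∀ᶠ t in l, ∀ k : Fin (d + 1), ∀ I J : Fin k → Fin d, 1 ≤ (k : ℕ) →
      StrictMono I → StrictMono J → (∀ p, I p ≤ J p) → 0 < ((f t).submatrix I J).det := by
    refine eventually_all.2 fun k => eventually_all.2 fun I => eventually_all.2 fun J => ?_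
    simp only [eventually_imp_distrib_left]
    intro hk hI hJ hIJ
    have hc : Continuous fun m : Matrix (Fin d) (Fin d) ℝ => (m.submatrix I J).det :=
      (continuous_id.matrix_submatrix I J).matrix_det
    exact ((hc.tendsto w).comp hf).eventually_const_lt
      (hw k hk (Nat.lt_succ_iff.1 k.isLt) I J hI hJ hIJ)
  exact h.mono fun t ht k hk hkd I J => ht ⟨k, Nat.lt_succ_of_le hkd⟩ I J hk

/-- For any upper triangular unipotent matrices `v` and `v'`,
the product `v' * Q_d ^ t * v` is totally positive for all sufficiently large
natural numbers `t`. -/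
theorem eventually_totallyPositive_conj_pascal_pow {d : ℕ}
    (v v' : Matrix (Fin d) (Fin d) ℝ)
    (hv : UTUnipotent v) (hv' : UTUnipotent v') :
    ∃ T : ℕ, ∀ t : ℕ, T ≤ t → TotallyPositive (v' * pascal d ^ t * v) := by
  have hlim : Tendsto (fun t : ℕ => diagConj (t : ℝ) v' * pascal d * diagConj (t : ℝ) v) atTop
      (𝓝 (pascal d)) := by
    simpa using ((tendsto_diagConj_atTop hv').mul_const (pascal d)).mul (tendsto_diagConj_atTop hv)
  obtain ⟨T, hT⟩ := eventually_atTop.1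
    (((totallyPositive_pascal d).eventually_of_tendsto hlim).and (eventually_gt_atTop 0))
  refine ⟨T, fun t ht k hk hkd I J hI hJ hIJ => ?_⟩
  obtain ⟨hpos, ht0⟩ := hT t ht
  have ht' : (0 : ℝ) < t := Nat.cast_pos.2 ht0
  refine det_submatrix_pos_of_diagConj ht' ?_
  rw [diagConj_mul ht'.ne', diagConj_mul ht'.ne', diagConj_pascal_pow ht0.ne']
  exact hpos k hk hkd I J hI hJ hIJ
end
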